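/- arXiv:2104.08187 — 2 statements merged into one kernel-verified Lean document; each statement's English description precedes it below -/
import Mathlib

section
/- The lattice L = L_p satisfies p·L^∨ ⊆ L, and the quotient group L^∨/L has order p^ν; in particular the discriminant group L^∨/L is an elementary abelian p-group of rank ν. -/
open scoped BigOperators

namespace Nikulin

noncomputable section

/-- Index set for the basis vectors `D_{i,j}`, `1 ≤ i ≤ ν`, `1 ≤ j ≤ p−1`. -/
abbrev Idx (p ν : ℕ) := Fin ν × Fin (p - 1)

variable (p ν : ℕ)

/-- The Gram matrix of the form `B` on the basis `D_{i,j}`: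
`B(D_{i,j}, D_{i,j}) = −2`, `B(D_{i,j}, D_{i,j±1}) = 1`, all other entries `0`. -/
def gram (a b : Idx p ν) : ℚ :=
  if a.1 = b.1 then
    if a.2 = b.2 then -2
    else if a.2.1 + 1 = b.2.1 ∨ b.2.1 + 1 = a.2.1 then 1 else 0
  else 0

/-- The symmetric bilinear form `B` on `V`, the bilinear extension of the Gram matrix. -/
def Bf : (Idx p ν → ℚ) →ₗ[ℚ] (Idx p ν → ℚ) →ₗ[ℚ] ℚ :=
  LinearMap.mk₂ ℚ (fun x y => ∑ a : Idx p ν, ∑ b : Idx p ν, x a * gram p ν a b * y b)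
    (by
      intro x x' y
      rw [← Finset.sum_add_distrib]
      refine Finset.sum_congr rfl fun a _ => ?_
      rw [← Finset.sum_add_distrib]
      refine Finset.sum_congr rfl fun b _ => ?_
      simp only [Pi.add_apply]; ring)
    (by
      intro c x y
      rw [Finset.smul_sum]
      refine Finset.sum_congr rfl fun a _ => ?_
      rw [Finset.smul_sum]
      refine Finset.sum_congr rfl fun b _ => ?_
      simp only [Pi.smul_apply, smul_eq_mul]; ring)
    (by
      intro x y y'
      rw [← Finset.sum_add_distrib]
      refine Finset.sum_congr rfl fun a _ => ?_
      rw [← Finset.sum_add_distrib]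
      refine Finset.sum_congr rfl fun b _ => ?_
      simp only [Pi.add_apply]; ring)
    (by
      intro c x y
      rw [Finset.smul_sum]
      refine Finset.sum_congr rfl fun a _ => ?_
      rw [Finset.smul_sum]
      refine Finset.sum_congr rfl fun b _ => ?_
      simp only [Pi.smul_apply, smul_eq_mul]; ring)

/-- The basis vector `D_{i,j}` (the index `q = (i, j)` with `j ∈ Fin (p−1)` representing
`j+1 ∈ {1, …, p−1}`). -/
def Dv (q : Idx p ν) : Idx p ν → ℚ := Pi.single q 1

variable (k : Fin ν → ℤ)

/-- The vector `ϖ = Σ_i (k_i/p) Σ_j j·D_{i,j}`. -/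
def varpi : Idx p ν → ℚ := fun q => (k q.1 : ℚ) * ((q.2.1 : ℚ) + 1) / p

/-- The Nikulin lattice `N_p`, generated by the `D_{i,j}` together with `ϖ`. -/
def NL : AddSubgroup (Idx p ν → ℚ) :=
  AddSubgroup.closure (Set.range (Dv p ν) ∪ {varpi p ν k})

/-- The Weyl vector `ϱ = −(1/2) Σ_i Σ_j j(p−j)·D_{i,j}`. -/
def rho : Idx p ν → ℚ :=
  fun q => -(((q.2.1 : ℚ) + 1) * ((p : ℚ) - ((q.2.1 : ℚ) + 1)) / 2)

/-- The lattice `L_p = {x ∈ N_p : B(ϱ, x) ∈ pℤ}`. -/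
def LL : AddSubgroup (Idx p ν → ℚ) where
  carrier := {x | x ∈ NL p ν k ∧ ∃ m : ℤ, Bf p ν (rho p ν) x = (p : ℚ) * m}
  zero_mem' := ⟨(NL p ν k).zero_mem, 0, by simp⟩
  add_mem' := by
    rintro a b ⟨haN, ma, hma⟩ ⟨hbN, mb, hmb⟩
    exact ⟨add_mem haN hbN, ma + mb, by rw [map_add, hma, hmb]; push_cast; ring⟩
  neg_mem' := by
    rintro a ⟨haN, ma, hma⟩
    exact ⟨neg_mem haN, -ma, by rw [map_neg, hma]; push_cast; ring⟩

/-- The dual lattice `S^∨ = {y ∈ V : B(y, s) ∈ ℤ for all s ∈ S}`. -/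
def dual (S : AddSubgroup (Idx p ν → ℚ)) : AddSubgroup (Idx p ν → ℚ) where
  carrier := {y | ∀ s ∈ S, ∃ m : ℤ, Bf p ν y s = (m : ℚ)}
  zero_mem' := by
    intro s hs
    exact ⟨0, by simp⟩
  add_mem' := by
    rintro a b ha hb s hs
    obtain ⟨ma, hma⟩ := ha s hs
    obtain ⟨mb, hmb⟩ := hb s hs
    exact ⟨ma + mb, by rw [map_add, LinearMap.add_apply, hma, hmb]; push_cast; ring⟩
  neg_mem' := by
    rintro a ha s hs
    obtain ⟨m, hm⟩ := ha s hs
    exact ⟨-m, by rw [map_neg, LinearMap.neg_apply, hm]; push_cast; ring⟩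

/-- The list of admissible data `(p, ν, k)`:
`(2, 8, (1,…,1))`, `(3, 6, (1,…,1))`, `(5, 4, (1,1,2,2))`, `(7, 3, (1,2,3))`. -/
def goodCase : Prop :=
  (p = 2 ∧ ∃ h : ν = 8, ∀ i, k i = ![1, 1, 1, 1, 1, 1, 1, 1] (Fin.cast h i)) ∨
  (p = 3 ∧ ∃ h : ν = 6, ∀ i, k i = ![1, 1, 1, 1, 1, 1] (Fin.cast h i)) ∨
  (p = 5 ∧ ∃ h : ν = 4, ∀ i, k i = ![1, 1, 2, 2] (Fin.cast h i)) ∨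
  (p = 7 ∧ ∃ h : ν = 3, ∀ i, k i = ![1, 2, 3] (Fin.cast h i))

end

end Nikulin

namespace Nikulin

/-- The integers as a subring of `ℚ`. -/
def intQ : Subring ℚ := (Int.castRingHom ℚ).range

lemma mem_intQ {x : ℚ} : x ∈ intQ ↔ ∃ m : ℤ, x = m := by
  simp [intQ, RingHom.mem_range, eq_comm]

/-- If `S` is cut out in `T` by the congruences `ℓ i ≡ 0 mod p`, and the integral functionals
`ℓ i` are jointly surjective modulo `p`, then `S` has index `p ^ |ι|` in `T`. -/
lemma relIndex_eq_pow {V ι : Type*} [AddCommGroup V] [Fintype ι] (p : ℕ)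
    (S T : AddSubgroup V) (ℓ : ι → V →+ ℚ)
    (hint : ∀ x ∈ T, ∀ i, ℓ i x ∈ intQ)
    (hS : ∀ x ∈ T, (x ∈ S ↔ ∀ i, ∃ m : ℤ, ℓ i x = p * m))
    (hsurj : ∀ c : ι → ℤ, ∃ x ∈ T, ∀ i, ∃ m : ℤ, ℓ i x = c i + p * m) :
    S.relIndex T = p ^ Fintype.card ι := by
  let φ : T →+ (ι → ZMod p) :=
    { toFun := fun x i => ((⌊ℓ i x⌋ : ℤ) : ZMod p)
      map_zero' := by ext i; simp
      map_add' := by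
        intro x y
        ext i
        obtain ⟨m, hm⟩ := mem_intQ.1 (hint x x.2 i)
        obtain ⟨n, hn⟩ := mem_intQ.1 (hint y y.2 i)
        have h : ℓ i ((x + y : T) : V) = ((m + n : ℤ) : ℚ) := by
          rw [AddSubgroup.coe_add, map_add, hm, hn]; push_cast; ring
        simp only [Pi.add_apply, h, hm, hn, Int.floor_intCast]
        push_cast; ring }
  have hker : S.addSubgroupOf T = φ.ker := by
    ext x
    rw [AddSubgroup.mem_addSubgroupOf, hS x x.2, AddMonoidHom.mem_ker, funext_iff]
    refine forall_congr' fun i => ?_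
    obtain ⟨n, hn⟩ := mem_intQ.1 (hint x x.2 i)
    change _ ↔ ((⌊ℓ i x⌋ : ℤ) : ZMod p) = 0
    rw [hn, Int.floor_intCast, ZMod.intCast_zmod_eq_zero_iff_dvd]
    exact ⟨fun ⟨m, hm⟩ => ⟨m, by exact_mod_cast hm⟩, fun ⟨m, hm⟩ => ⟨m, by exact_mod_cast hm⟩⟩
  have hφ : Function.Surjective φ := by
    intro c
    choose d hd using fun i => ZMod.intCast_surjective (c i)
    obtain ⟨x, hxT, hx⟩ := hsurj d
    refine ⟨⟨x, hxT⟩, funext fun i => ?_⟩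
    obtain ⟨m, hm⟩ := hx i
    have h : ℓ i x = ((d i + p * m : ℤ) : ℚ) := by rw [hm]; push_cast; ring
    change ((⌊ℓ i x⌋ : ℤ) : ZMod p) = c i
    rw [h, Int.floor_intCast, ← hd i]
    simp
  rw [AddSubgroup.relIndex, hker, AddSubgroup.index_ker, AddMonoidHom.range_eq_top.2 hφ,
    AddSubgroup.card_top, Nat.card_fun, Nat.card_zmod, Nat.card_eq_fintype_card]

/-- A one-functional version of `relIndex_eq_pow`. -/
lemma relIndex_eq_self {V : Type*} [AddCommGroup V] (p : ℕ)
    (S T : AddSubgroup V) (ℓ : V →+ ℚ) (hint : ∀ x ∈ T, ℓ x ∈ intQ)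
    (hS : ∀ x ∈ T, (x ∈ S ↔ ∃ m : ℤ, ℓ x = p * m))
    (hsurj : ∃ x ∈ T, ∃ m : ℤ, ℓ x = 1 + p * m) :
    S.relIndex T = p := by
  obtain ⟨x, hxT, m, hm⟩ := hsurj
  simpa using relIndex_eq_pow (ι := Unit) p S T (fun _ => ℓ) (fun x hx _ => hint x hx)
    (fun x hx => by simpa using hS x hx)
    (fun c => ⟨c () • x, T.zsmul_mem hxT _, fun _ => ⟨c () * m, by
      simp only [map_zsmul, hm, zsmul_eq_mul]; push_cast; ring⟩⟩)

/-- A vector space over `ZMod p` of order `p ^ n` is isomorphic to `(ZMod p) ^ n`. -/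
lemma nonempty_linearEquiv_of_card {G : Type*} [AddCommGroup G] (p n : ℕ) [Fact p.Prime]
    [Module (ZMod p) G] (hcard : Nat.card G = p ^ n) :
    Nonempty (G ≃ₗ[ZMod p] (Fin n → ZMod p)) := by
  have hp : 1 < p := (Fact.out : p.Prime).one_lt
  have : Finite G := Nat.finite_of_card_ne_zero (by rw [hcard]; positivity)
  have hr : Module.finrank (ZMod p) G = n := by
    have := FiniteField.pow_finrank_eq_natCard p G
    rw [hcard] at this
    exact Nat.pow_right_injective hp this
  refine FiniteDimensional.nonempty_linearEquiv_of_finrank_eq ?_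
  rw [hr, Module.finrank_fin_fun]

/-- A finite abelian group of exponent dividing `p` and order `p ^ n` is elementary abelian. -/
lemma nonempty_addEquiv_of_card {G : Type*} [AddCommGroup G] (p n : ℕ) [Fact p.Prime]
    (h : ∀ g : G, p • g = 0) (hcard : Nat.card G = p ^ n) :
    Nonempty (G ≃+ (Fin n → ZMod p)) :=
  let : Module (ZMod p) G := AddCommGroup.zmodModule h
  (nonempty_linearEquiv_of_card p n hcard).map LinearEquiv.toAddEquiv

section Form

variable {p ν : ℕ}

/-- The coefficients of `x` on the `i`-th root system, indexed by `1, …, p - 1` and extended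
by zero. -/
def ext (x : Idx p ν → ℚ) (i : Fin ν) (n : ℕ) : ℚ :=
  if h : 1 ≤ n ∧ n - 1 < p - 1 then x (i, ⟨n - 1, h.2⟩) else 0

lemma ext_succ (x : Idx p ν → ℚ) (i : Fin ν) (j : Fin (p - 1)) :
    ext x i (j.1 + 1) = x (i, j) := by
  simp [ext]

lemma ext_eq_zero (x : Idx p ν → ℚ) (i : Fin ν) {n : ℕ} (h : n = 0 ∨ p ≤ n) :
    ext x i n = 0 := by
  rw [ext, dif_neg]
  omega

lemma sum_ite_eq_ext (x : Idx p ν → ℚ) (i : Fin ν) (n : ℕ) :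
    ∑ b : Fin (p - 1), (if b.1 + 1 = n then x (i, b) else 0) = ext x i n := by
  by_cases h : 1 ≤ n ∧ n - 1 < p - 1
  · rw [Finset.sum_eq_single ⟨n - 1, h.2⟩]
    · rw [ext, dif_pos h, if_pos (by simp; omega)]
    · intro b _ hb
      rw [if_neg]
      rintro rfl
      exact hb (by simp)
    · simp
  · rw [ext, dif_neg h]
    refine Finset.sum_eq_zero fun b _ => if_neg ?_
    have := b.2
    omega

lemma Bf_apply (x y : Idx p ν → ℚ) :
    Bf p ν x y = ∑ a : Idx p ν, ∑ b : Idx p ν, x a * gram p ν a b * y b := rfl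

lemma Bf_comm (x y : Idx p ν → ℚ) : Bf p ν x y = Bf p ν y x := by
  rw [Bf_apply, Bf_apply, Finset.sum_comm]
  refine Finset.sum_congr rfl fun a _ => Finset.sum_congr rfl fun b _ => ?_
  have : gram p ν a b = gram p ν b a := by
    unfold gram
    simp only [eq_comm (a := a.1), eq_comm (a := a.2), or_comm]
  rw [this]; ring

lemma Bf_Dv (x : Idx p ν → ℚ) (i : Fin ν) (j : Fin (p - 1)) :
    Bf p ν x (Dv p ν (i, j)) = ext x i j.1 + ext x i (j.1 + 2) - 2 * ext x i (j.1 + 1) := by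
  rw [Bf_apply]
  simp only [Dv, Pi.single_apply, mul_ite, mul_one, mul_zero, Finset.sum_ite_eq',
    Finset.mem_univ, if_true]
  rw [Fintype.sum_prod_type, Finset.sum_eq_single i]
  · rw [← sum_ite_eq_ext x i j.1, ← sum_ite_eq_ext x i (j.1 + 2), ← sum_ite_eq_ext x i (j.1 + 1),
      Finset.mul_sum, ← Finset.sum_add_distrib, ← Finset.sum_sub_distrib]
    refine Finset.sum_congr rfl fun b _ => ?_
    simp only [gram, if_true, Fin.ext_iff]
    split_ifs <;> first | omega | ring
  · intro a _ ha
    refine Finset.sum_eq_zero fun b _ => ?_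
    simp [gram, ha]
  · simp

lemma eq_sum_Dv (y : Idx p ν → ℚ) : y = ∑ q, y q • Dv p ν q := by
  ext a
  simp [Dv, Finset.sum_apply, Pi.single_apply]

lemma Bf_eq_sum (x y : Idx p ν → ℚ) :
    Bf p ν x y = ∑ q, y q * Bf p ν x (Dv p ν q) := by
  conv_lhs => rw [eq_sum_Dv y]
  simp

lemma Bf_rho_Dv (q : Idx p ν) : Bf p ν (rho p ν) (Dv p ν q) = 1 := by
  obtain ⟨i, j⟩ := q
  have key : ∀ n : ℕ, n ≤ p → ext (rho p ν) i n = -((n : ℚ) * ((p : ℚ) - n) / 2) := by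
    intro n hn
    by_cases h : n = 0 ∨ p ≤ n
    · rw [ext_eq_zero _ _ h]
      rcases h with rfl | h
      · simp
      · rw [le_antisymm hn h]; simp
    · obtain ⟨m, rfl⟩ : ∃ m, n = m + 1 := ⟨n - 1, by omega⟩
      have := ext_succ (rho p ν) i ⟨m, by omega⟩
      simp only at this
      rw [this]
      simp [rho]
  have := j.2
  rw [Bf_Dv, key _ (by omega), key _ (by omega), key _ (by omega)]
  push_cast
  ring

lemma Bf_rho (x : Idx p ν → ℚ) : Bf p ν (rho p ν) x = ∑ q, x q := by
  rw [Bf_eq_sum]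
  simp [Bf_rho_Dv]

lemma Bf_varpi_Dv (k : Fin ν → ℤ) (i : Fin ν) (j : Fin (p - 1)) :
    Bf p ν (varpi p ν k) (Dv p ν (i, j)) = if j.1 + 2 = p then -(k i : ℚ) else 0 := by
  have hj := j.2
  have key : ∀ n : ℕ, n < p → ext (varpi p ν k) i n = (k i : ℚ) * n / p := by
    intro n hn
    by_cases h : n = 0
    · rw [ext_eq_zero _ _ (Or.inl h), h]; simp
    · obtain ⟨m, rfl⟩ : ∃ m, n = m + 1 := ⟨n - 1, by omega⟩
      have := ext_succ (varpi p ν k) i ⟨m, by omega⟩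
      simp only at this
      rw [this]
      simp [varpi]
  have hp : (p : ℚ) ≠ 0 := by
    have : p ≠ 0 := by omega
    exact_mod_cast this
  rw [Bf_Dv, key j.1 (by omega), key (j.1 + 1) (by omega)]
  split_ifs with h
  · rw [ext_eq_zero _ _ (Or.inr h.ge)]
    have : (p : ℚ) = j.1 + 2 := by exact_mod_cast h.symm
    rw [this] at hp ⊢
    push_cast
    field_simp
    ring
  · rw [key _ (by omega)]
    push_cast
    ring

lemma Bf_varpi (hp : 2 ≤ p) (k : Fin ν → ℤ) (x : Idx p ν → ℚ) :
    Bf p ν (varpi p ν k) x = -∑ i, (k i : ℚ) * x (i, ⟨p - 2, by omega⟩) := by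
  rw [Bf_eq_sum, Fintype.sum_prod_type, ← Finset.sum_neg_distrib]
  refine Finset.sum_congr rfl fun i _ => ?_
  rw [Finset.sum_eq_single ⟨p - 2, by omega⟩]
  · rw [Bf_varpi_Dv, if_pos (by simp; omega)]
    ring
  · intro j _ hj
    rw [Bf_varpi_Dv, if_neg, mul_zero]
    intro h
    exact hj (Fin.ext (by simp; omega))
  · simp

end Form

section Lattices

variable (p ν : ℕ)

/-- The root lattice generated by the `D_{i,j}`. -/
def rootLattice : AddSubgroup (Idx p ν → ℚ) where
  carrier := {x | ∀ q, x q ∈ intQ}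
  zero_mem' := fun _ => intQ.zero_mem
  add_mem' := fun ha hb q => intQ.add_mem (ha q) (hb q)
  neg_mem' := fun ha q => intQ.neg_mem (ha q)

variable {p ν}

lemma mem_dual {S : AddSubgroup (Idx p ν → ℚ)} {y : Idx p ν → ℚ} :
    y ∈ dual p ν S ↔ ∀ s ∈ S, Bf p ν y s ∈ intQ := by
  simp only [mem_intQ]
  rfl

lemma dual_anti {S T : AddSubgroup (Idx p ν → ℚ)} (h : S ≤ T) : dual p ν T ≤ dual p ν S :=
  fun _ hy s hs => hy s (h hs)

lemma Dv_mem_rootLattice (q : Idx p ν) : Dv p ν q ∈ rootLattice p ν := by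
  intro a
  rw [Dv, Pi.single_apply]
  split_ifs
  exacts [intQ.one_mem, intQ.zero_mem]

lemma mem_dual_rootLattice {y : Idx p ν → ℚ} :
    y ∈ dual p ν (rootLattice p ν) ↔ ∀ q, Bf p ν y (Dv p ν q) ∈ intQ := by
  rw [mem_dual]
  refine ⟨fun h q => h _ (Dv_mem_rootLattice q), fun h s hs => ?_⟩
  rw [Bf_eq_sum]
  exact sum_mem fun q _ => intQ.mul_mem (hs q) (h q)

lemma rootLattice_le_dual : rootLattice p ν ≤ dual p ν (rootLattice p ν) := by
  intro x hx
  rw [mem_dual_rootLattice]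
  rintro ⟨i, j⟩
  have h : ∀ n, ext x i n ∈ intQ := by
    intro n
    unfold ext
    split_ifs
    exacts [hx _, intQ.zero_mem]
  rw [Bf_Dv]
  exact sub_mem (add_mem (h _) (h _)) (intQ.mul_mem (ofNat_mem intQ 2) (h _))

variable (k : Fin ν → ℤ)

lemma rootLattice_le_NL : rootLattice p ν ≤ NL p ν k := by
  intro x hx
  rw [eq_sum_Dv x]
  refine sum_mem fun q _ => ?_
  obtain ⟨m, hm⟩ := mem_intQ.1 (hx q)
  rw [hm, Int.cast_smul_eq_zsmul]
  exact (NL p ν k).zsmul_mem (AddSubgroup.subset_closure (Or.inl ⟨q, rfl⟩)) m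

lemma varpi_mem_NL : varpi p ν k ∈ NL p ν k := AddSubgroup.subset_closure (Or.inr rfl)

lemma mem_NL {x : Idx p ν → ℚ} :
    x ∈ NL p ν k ↔ ∃ n : ℤ, x - n • varpi p ν k ∈ rootLattice p ν := by
  constructor
  · intro hx
    induction hx using AddSubgroup.closure_induction with
    | mem x hx =>
      rcases hx with ⟨q, rfl⟩ | rfl
      · exact ⟨0, by simpa using Dv_mem_rootLattice q⟩
      · exact ⟨1, by simp⟩
    | zero => exact ⟨0, by simp⟩
    | add x y _ _ hx hy =>
      obtain ⟨m, hm⟩ := hx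
      obtain ⟨n, hn⟩ := hy
      refine ⟨m + n, ?_⟩
      convert add_mem hm hn using 1
      rw [add_smul]; abel
    | neg x _ hx =>
      obtain ⟨m, hm⟩ := hx
      refine ⟨-m, ?_⟩
      convert neg_mem hm using 1
      rw [neg_smul]; abel
  · rintro ⟨n, hn⟩
    have := add_mem (rootLattice_le_NL k hn) (zsmul_mem (varpi_mem_NL k) n)
    simpa using this

lemma mem_dual_NL {y : Idx p ν → ℚ} : y ∈ dual p ν (NL p ν k) ↔
    y ∈ dual p ν (rootLattice p ν) ∧ Bf p ν y (varpi p ν k) ∈ intQ := by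
  refine ⟨fun h => ⟨dual_anti (rootLattice_le_NL k) h, mem_dual.1 h _ (varpi_mem_NL k)⟩, ?_⟩
  rintro ⟨hA, hw⟩
  rw [mem_dual]
  intro s hs
  obtain ⟨n, hn⟩ := (mem_NL k).1 hs
  have := add_mem (mem_dual.1 hA _ hn) (zsmul_mem hw n)
  rwa [← map_zsmul, ← map_add, sub_add_cancel] at this

lemma mem_LL {x : Idx p ν → ℚ} :
    x ∈ LL p ν k ↔ x ∈ NL p ν k ∧ ∃ m : ℤ, Bf p ν (rho p ν) x = (p : ℚ) * m := Iff.rfl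

lemma LL_le_NL : LL p ν k ≤ NL p ν k := fun _ h => h.1

lemma smul_varpi_mem (hp : p ≠ 0) : (p : ℤ) • varpi p ν k ∈ rootLattice p ν := by
  intro q
  refine mem_intQ.2 ⟨k q.1 * (q.2.1 + 1), ?_⟩
  have : (p : ℚ) ≠ 0 := by exact_mod_cast hp
  rw [Pi.smul_apply, zsmul_eq_mul, varpi]
  push_cast
  field_simp

/-- The coefficients of a dual vector are determined modulo `ℤ` by the first one. -/
lemma ext_sub_mem {y : Idx p ν → ℚ} (hy : y ∈ dual p ν (rootLattice p ν)) (i : Fin ν) :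
    ∀ n : ℕ, n ≤ p → ext y i n - n * ext y i 1 ∈ intQ := by
  intro n
  induction n using Nat.strong_induction_on with
  | _ n ih =>
    intro hn
    match n, ih, hn with
    | 0, _, _ => simp [ext_eq_zero y i (Or.inl rfl), intQ.zero_mem]
    | 1, _, _ => simp [intQ.zero_mem]
    | n + 2, ih, hn =>
      have h0 := ih n (by omega) (by omega)
      have h1 := ih (n + 1) (by omega) (by omega)
      have h2 := mem_dual_rootLattice.1 hy (i, ⟨n, by omega⟩)
      rw [Bf_Dv] at h2
      convert add_mem (sub_mem h2 h0) (intQ.mul_mem (ofNat_mem intQ 2) h1) using 1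
      push_cast
      ring

lemma smul_mem_rootLattice (hp : 2 ≤ p) {y : Idx p ν → ℚ}
    (hy : y ∈ dual p ν (rootLattice p ν)) (i : Fin ν) :
    (p : ℚ) * y (i, ⟨0, by omega⟩) ∈ intQ := by
  have h := ext_sub_mem hy i p le_rfl
  have h1 := ext_succ y i ⟨0, by omega⟩
  simp only [zero_add] at h1
  rw [ext_eq_zero y i (Or.inr le_rfl), h1] at h
  simpa using neg_mem h

lemma coeff_sub_mem (hp : 2 ≤ p) {y : Idx p ν → ℚ}
    (hy : y ∈ dual p ν (rootLattice p ν)) (i : Fin ν) (j : Fin (p - 1)) :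
    y (i, j) - ((j.1 + 1 : ℕ) : ℚ) * y (i, ⟨0, by omega⟩) ∈ intQ := by
  have h := ext_sub_mem hy i (j.1 + 1) (by omega)
  have h1 := ext_succ y i ⟨0, by omega⟩
  simp only [zero_add] at h1
  rwa [ext_succ, h1] at h

lemma zsmul_mem_rootLattice (hp : 2 ≤ p) {y : Idx p ν → ℚ}
    (hy : y ∈ dual p ν (rootLattice p ν)) : (p : ℤ) • y ∈ rootLattice p ν := by
  rintro ⟨i, j⟩
  convert add_mem (intQ.mul_mem (natCast_mem intQ p) (coeff_sub_mem hp hy i j))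
    (intQ.mul_mem (natCast_mem intQ (j.1 + 1)) (smul_mem_rootLattice hp hy i)) using 1
  rw [Pi.smul_apply, zsmul_eq_mul]
  push_cast
  ring

/-- Evaluation at a coordinate, multiplied by `p`. -/
def scaledCoord (q : Idx p ν) : (Idx p ν → ℚ) →+ ℚ where
  toFun x := p * x q
  map_zero' := by simp
  map_add' := by intro x y; simp [mul_add]

/-- Pairing with a fixed vector, multiplied by `p`. -/
def scaledPairing (s : Idx p ν → ℚ) : (Idx p ν → ℚ) →+ ℚ where
  toFun x := p * Bf p ν x s
  map_zero' := by simp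
  map_add' := by intro x y; simp [mul_add]

lemma exists_mul_eq_iff (hp : p ≠ 0) {a : ℚ} : (∃ m : ℤ, (p : ℚ) * a = p * m) ↔ a ∈ intQ := by
  have : (p : ℚ) ≠ 0 := by exact_mod_cast hp
  rw [mem_intQ]
  exact exists_congr fun m => mul_right_inj' this

lemma varpi_mem_dual : varpi p ν k ∈ dual p ν (rootLattice p ν) := by
  rw [mem_dual_rootLattice]
  rintro ⟨i, j⟩
  rw [Bf_varpi_Dv]
  split_ifs
  exacts [neg_mem (intCast_mem intQ _), intQ.zero_mem]

lemma relIndex_rootLattice_dual (hp : 2 ≤ p) :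
    (rootLattice p ν).relIndex (dual p ν (rootLattice p ν)) = p ^ ν := by
  have hp0 : (p : ℚ) ≠ 0 := by
    have : p ≠ 0 := by omega
    exact_mod_cast this
  have := relIndex_eq_pow p (rootLattice p ν) (dual p ν (rootLattice p ν))
    (fun i : Fin ν => scaledCoord (i, ⟨0, by omega⟩))
    (fun x hx i => smul_mem_rootLattice hp hx i)
    (fun x hx => by
      change _ ↔ ∀ i, ∃ m : ℤ, (p : ℚ) * x (i, ⟨0, by omega⟩) = p * m
      simp only [exists_mul_eq_iff (show p ≠ 0 by omega)]
      refine ⟨fun h i => h _, ?_⟩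
      rintro h ⟨i, j⟩
      convert add_mem (coeff_sub_mem hp hx i j)
        (intQ.mul_mem (natCast_mem intQ (j.1 + 1)) (h i)) using 1
      ring)
    (fun c => ⟨varpi p ν c, varpi_mem_dual c, fun i => ⟨0, by
      change (p : ℚ) * varpi p ν c _ = _
      simp only [varpi]
      field_simp
      simp⟩⟩)
  simpa using this

lemma relIndex_rootLattice_NL (hp : 2 ≤ p) {i₀ : Fin ν} (hi : k i₀ = 1) :
    (rootLattice p ν).relIndex (NL p ν k) = p := by
  have hp0 : (p : ℚ) ≠ 0 := by
    have : p ≠ 0 := by omega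
    exact_mod_cast this
  have hw : (p : ℚ) * varpi p ν k (i₀, ⟨0, by omega⟩) = 1 := by
    simp [varpi, hi, hp0]
  refine relIndex_eq_self p _ _ (scaledCoord (i₀, ⟨0, by omega⟩)) (fun x hx => ?_)
    (fun x hx => ?_) ⟨varpi p ν k, varpi_mem_NL k, 0, by simpa [scaledCoord] using hw⟩
  all_goals
    obtain ⟨n, hn⟩ := (mem_NL k).1 hx
    have h0 := hn (i₀, ⟨0, by omega⟩)
    simp only [Pi.sub_apply, Pi.smul_apply] at h0
    rw [zsmul_eq_mul] at h0
  · change (p : ℚ) * x _ ∈ intQ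
    convert add_mem (intQ.mul_mem (natCast_mem intQ p) h0) (intCast_mem intQ n) using 1
    linear_combination (n : ℚ) * hw
  · change _ ↔ ∃ m : ℤ, (p : ℚ) * x _ = p * m
    rw [exists_mul_eq_iff (show p ≠ 0 by omega)]
    refine ⟨fun h => h _, fun h => ?_⟩
    obtain ⟨m, hm⟩ := mem_intQ.1 (sub_mem h h0)
    have hnm : (n : ℚ) = (m * p : ℤ) := by
      push_cast
      linear_combination (p : ℚ) * hm - (n : ℚ) * hw
    have hnm' : n = m * p := by exact_mod_cast hnm
    have := add_mem hn (zsmul_mem (smul_varpi_mem k (show p ≠ 0 by omega)) m)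
    rwa [smul_smul, ← hnm', sub_add_cancel] at this

lemma relIndex_dual_NL (hp : 2 ≤ p) {i₀ : Fin ν} (hi : k i₀ = 1) :
    (dual p ν (NL p ν k)).relIndex (dual p ν (rootLattice p ν)) = p := by
  have hp0 : (p : ℚ) ≠ 0 := by
    have : p ≠ 0 := by omega
    exact_mod_cast this
  refine relIndex_eq_self p _ _ (scaledPairing (varpi p ν k)) (fun x hx => ?_) (fun x hx => ?_)
    ⟨varpi p ν (Pi.single i₀ 1), varpi_mem_dual _, -1, ?_⟩
  · have := mem_dual.1 hx _ (smul_varpi_mem k (show p ≠ 0 by omega))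
    rwa [map_zsmul, zsmul_eq_mul] at this
  · change _ ↔ ∃ m : ℤ, (p : ℚ) * Bf p ν x (varpi p ν k) = p * m
    rw [exists_mul_eq_iff (show p ≠ 0 by omega), mem_dual_NL]
    simp [hx]
  · change (p : ℚ) * Bf p ν _ _ = _
    rw [Bf_varpi hp, Finset.sum_eq_single i₀]
    · simp only [varpi, hi, Pi.single_eq_same]
      rw [Nat.cast_sub hp]
      push_cast
      field_simp
      ring
    · intro i _ h
      simp [h]
    · simp

lemma relIndex_LL_NL (hint : Bf p ν (rho p ν) (varpi p ν k) ∈ intQ) (q₀ : Idx p ν) :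
    (LL p ν k).relIndex (NL p ν k) = p := by
  have hrho : rho p ν ∈ dual p ν (NL p ν k) := (mem_dual_NL k).2
    ⟨mem_dual_rootLattice.2 fun q => by rw [Bf_rho_Dv]; exact intQ.one_mem, hint⟩
  refine relIndex_eq_self p _ _ (Bf p ν (rho p ν)).toAddMonoidHom (mem_dual.1 hrho)
    (fun x hx => by simp [mem_LL, hx])
    ⟨Dv p ν q₀, rootLattice_le_NL k (Dv_mem_rootLattice _), 0, by simp [Bf_rho_Dv]⟩

lemma mem_dual_NL_of_mem_dual_LL (hint : Bf p ν (rho p ν) (varpi p ν k) ∈ intQ) {q₀ : Idx p ν}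
    {y : Idx p ν → ℚ} (hy : y ∈ dual p ν (LL p ν k)) (h : Bf p ν y (Dv p ν q₀) ∈ intQ) :
    y ∈ dual p ν (NL p ν k) := by
  have hrho : rho p ν ∈ dual p ν (NL p ν k) := (mem_dual_NL k).2
    ⟨mem_dual_rootLattice.2 fun q => by rw [Bf_rho_Dv]; exact intQ.one_mem, hint⟩
  rw [mem_dual]
  intro s hs
  obtain ⟨c, hc⟩ := hrho s hs
  have hL : s - c • Dv p ν q₀ ∈ LL p ν k :=
    ⟨sub_mem hs (zsmul_mem (rootLattice_le_NL k (Dv_mem_rootLattice _)) _), 0, by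
      rw [map_sub, map_zsmul, Bf_rho_Dv, hc]; simp⟩
  have := add_mem (mem_dual.1 hy _ hL) (zsmul_mem h c)
  rwa [← map_zsmul, ← map_add, sub_add_cancel] at this

lemma smul_Dv_mem_LL (q : Idx p ν) : (p : ℤ) • Dv p ν q ∈ LL p ν k :=
  ⟨zsmul_mem (rootLattice_le_NL k (Dv_mem_rootLattice _)) _, 1, by
    rw [map_zsmul, Bf_rho_Dv]; simp⟩

lemma inv_smul_rho_mem (hp : p ≠ 0) : (p : ℚ)⁻¹ • rho p ν ∈ dual p ν (LL p ν k) := by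
  rintro s ⟨-, m, hm⟩
  have : (p : ℚ) ≠ 0 := by exact_mod_cast hp
  exact ⟨m, by simp [hm, this]⟩

lemma relIndex_dual_NL_dual_LL (hp : p ≠ 0)
    (hint : Bf p ν (rho p ν) (varpi p ν k) ∈ intQ) (q₀ : Idx p ν) :
    (dual p ν (NL p ν k)).relIndex (dual p ν (LL p ν k)) = p := by
  have hp0 : (p : ℚ) ≠ 0 := by exact_mod_cast hp
  refine relIndex_eq_self p _ _ (scaledPairing (Dv p ν q₀)) (fun x hx => ?_) (fun x hx => ?_)
    ⟨(p : ℚ)⁻¹ • rho p ν, inv_smul_rho_mem k hp, 0, ?_⟩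
  · have := mem_dual.1 hx _ (smul_Dv_mem_LL k q₀)
    rwa [map_zsmul, zsmul_eq_mul] at this
  · change _ ↔ ∃ m : ℤ, (p : ℚ) * Bf p ν x (Dv p ν q₀) = p * m
    rw [exists_mul_eq_iff hp]
    exact ⟨fun h => mem_dual.1 h _ (rootLattice_le_NL k (Dv_mem_rootLattice _)),
      mem_dual_NL_of_mem_dual_LL k hint hx⟩
  · simp [scaledPairing, Bf_rho_Dv, hp0]

lemma NL_le_dual_NL (hww : Bf p ν (varpi p ν k) (varpi p ν k) ∈ intQ) :
    NL p ν k ≤ dual p ν (NL p ν k) := by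
  have hw : varpi p ν k ∈ dual p ν (NL p ν k) := (mem_dual_NL k).2 ⟨varpi_mem_dual k, hww⟩
  intro x hx
  obtain ⟨n, hn⟩ := (mem_NL k).1 hx
  have hA : x - n • varpi p ν k ∈ dual p ν (NL p ν k) :=
    (mem_dual_NL k).2 ⟨rootLattice_le_dual hn, by
      rw [Bf_comm]
      exact mem_dual.1 hw _ (rootLattice_le_NL k hn)⟩
  simpa using add_mem hA (zsmul_mem hw n)

lemma relIndex_LL_dual_LL (hp : 2 ≤ p) {i₀ : Fin ν} (hi : k i₀ = 1)
    (hint : Bf p ν (rho p ν) (varpi p ν k) ∈ intQ)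
    (hww : Bf p ν (varpi p ν k) (varpi p ν k) ∈ intQ) :
    (LL p ν k).relIndex (dual p ν (LL p ν k)) = p ^ ν := by
  have hN := NL_le_dual_NL k hww
  have q₀ : Idx p ν := (i₀, ⟨0, by omega⟩)
  rw [← relIndex_rootLattice_dual hp,
    ← AddSubgroup.relIndex_mul_relIndex _ _ _ (LL_le_NL k) (hN.trans (dual_anti (LL_le_NL k))),
    ← AddSubgroup.relIndex_mul_relIndex _ _ _ hN (dual_anti (LL_le_NL k)),
    ← AddSubgroup.relIndex_mul_relIndex _ _ _ (rootLattice_le_NL k)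
      (hN.trans (dual_anti (rootLattice_le_NL k))),
    ← AddSubgroup.relIndex_mul_relIndex _ _ _ hN (dual_anti (rootLattice_le_NL k)),
    relIndex_LL_NL k hint q₀, relIndex_dual_NL_dual_LL k (by omega) hint q₀,
    relIndex_rootLattice_NL k hp hi, relIndex_dual_NL k hp hi]

lemma smul_mem_LL (hp : 2 ≤ p) (q₀ : Idx p ν)
    (hint : Bf p ν (rho p ν) (varpi p ν k) ∈ intQ) (hrho : rho p ν ∈ LL p ν k)
    {y : Idx p ν → ℚ} (hy : y ∈ dual p ν (LL p ν k)) : (p : ℤ) • y ∈ LL p ν k := by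
  have hp0 : (p : ℚ) ≠ 0 := by
    have : p ≠ 0 := by omega
    exact_mod_cast this
  obtain ⟨c, hc⟩ := hy _ (smul_Dv_mem_LL k q₀)
  rw [map_zsmul, zsmul_eq_mul, Int.cast_natCast] at hc
  have hz : y - c • ((p : ℚ)⁻¹ • rho p ν) ∈ dual p ν (NL p ν k) := by
    refine mem_dual_NL_of_mem_dual_LL k hint (q₀ := q₀)
      (sub_mem hy (zsmul_mem (inv_smul_rho_mem k (by omega)) c)) (mem_intQ.2 ⟨0, ?_⟩)
    simp only [map_sub, map_zsmul, map_smul, LinearMap.sub_apply, LinearMap.smul_apply, Bf_rho_Dv]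
    rw [zsmul_eq_mul, ← hc, smul_eq_mul]
    field_simp
    simp
  have hL : (p : ℤ) • (y - c • ((p : ℚ)⁻¹ • rho p ν)) ∈ LL p ν k := by
    refine ⟨rootLattice_le_NL k
      (zsmul_mem_rootLattice hp (dual_anti (rootLattice_le_NL k) hz)), ?_⟩
    obtain ⟨m, hm⟩ := hz _ hrho.1
    exact ⟨m, by rw [map_zsmul, Bf_comm, hm]; simp⟩
  convert add_mem hL (zsmul_mem hrho c) using 1
  ext q
  simp only [Pi.smul_apply, Pi.add_apply, Pi.sub_apply]
  simp only [zsmul_eq_mul, smul_eq_mul]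
  push_cast
  field_simp
  ring

lemma rho_mem_rootLattice (hp : Odd p) : rho p ν ∈ rootLattice p ν := by
  intro q
  have hev : Even (((q.2.1 : ℤ) + 1) * (p - (q.2.1 + 1))) := by
    have : Odd (p : ℤ) := by exact_mod_cast hp
    rcases Int.even_or_odd ((q.2.1 : ℤ) + 1) with h | h
    · exact h.mul_right _
    · exact (this.sub_odd h).mul_left _
  obtain ⟨m, hm⟩ := hev
  refine mem_intQ.2 ⟨-m, ?_⟩
  have : ((q.2.1 : ℚ) + 1) * (p - (q.2.1 + 1)) = m + m := by exact_mod_cast hm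
  simp only [rho, this]
  push_cast
  ring

end Lattices

/-- The arithmetic properties shared by all admissible data. -/
lemma goodCase.facts {p ν : ℕ} {k : Fin ν → ℤ} (hk : goodCase p ν k) :
    p.Prime ∧ (∃ i, k i = 1) ∧ Bf p ν (rho p ν) (varpi p ν k) ∈ intQ ∧
      Bf p ν (varpi p ν k) (varpi p ν k) ∈ intQ ∧ rho p ν ∈ LL p ν k := by
  rcases hk with ⟨rfl, rfl, hk⟩ | ⟨rfl, rfl, hk⟩ | ⟨rfl, rfl, hk⟩ | ⟨rfl, rfl, hk⟩
  all_goals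
    obtain rfl := funext hk
    refine ⟨by norm_num, ⟨0, by simp⟩, mem_intQ.2 ?_, mem_intQ.2 ?_, ?_, ?_⟩
  all_goals try rw [Bf_rho, Fintype.sum_prod_type]
  all_goals try rw [Bf_varpi (by norm_num)]
  · exact ⟨4, by simp [varpi, Fin.sum_univ_succ]; norm_num⟩
  · exact ⟨-4, by simp [varpi, Fin.sum_univ_succ]; norm_num⟩
  · have : rho 2 8 = -varpi 2 8 fun i => ![1, 1, 1, 1, 1, 1, 1, 1] (Fin.cast rfl i) := by
      funext ⟨i, j⟩
      fin_cases i <;> fin_cases j <;> norm_num [rho, varpi]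
    rw [this]
    exact neg_mem (varpi_mem_NL _)
  · exact ⟨-2, by simp [rho]; norm_num⟩
  · exact ⟨6, by simp [varpi, Fin.sum_univ_succ]; norm_num⟩
  · exact ⟨-4, by simp [varpi, Fin.sum_univ_succ]; norm_num⟩
  · exact rootLattice_le_NL _ (rho_mem_rootLattice (by decide))
  · exact ⟨-4, by simp [rho, Fin.sum_univ_succ]; norm_num⟩
  · exact ⟨12, by simp [varpi, Fin.sum_univ_succ]; norm_num⟩
  · exact ⟨-8, by simp [varpi, Fin.sum_univ_succ]; norm_num⟩
  · exact rootLattice_le_NL _ (rho_mem_rootLattice (by decide))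
  · exact ⟨-8, by simp [rho, Fin.sum_univ_succ]; norm_num⟩
  · exact ⟨18, by simp [varpi, Fin.sum_univ_succ]; norm_num⟩
  · exact ⟨-12, by simp [varpi, Fin.sum_univ_succ]; norm_num⟩
  · exact rootLattice_le_NL _ (rho_mem_rootLattice (by decide))
  · exact ⟨-12, by simp [rho, Fin.sum_univ_succ]; norm_num⟩

end Nikulin

open Nikulin

/-- `L_p` satisfies `p·L^∨ ⊆ L` and `L^∨/L` is an elementary abelian `p`-group of rank `ν`. -/
theorem LLat_discriminant (p ν : ℕ) (k : Fin ν → ℤ) (hk : goodCase p ν k) :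
    (∀ y ∈ dual p ν (LL p ν k), (p : ℤ) • y ∈ LL p ν k) ∧
    Nat.card (↥(dual p ν (LL p ν k)) ⧸
        ((LL p ν k).addSubgroupOf (dual p ν (LL p ν k)))) = p ^ ν ∧
    Nonempty ((↥(dual p ν (LL p ν k)) ⧸
        ((LL p ν k).addSubgroupOf (dual p ν (LL p ν k)))) ≃+ (Fin ν → ZMod p)) := by
  obtain ⟨hp, ⟨i₀, hi⟩, hint, hww, hrho⟩ := hk.facts
  have := Fact.mk hp
  have hsmul : ∀ y ∈ dual p ν (LL p ν k), (p : ℤ) • y ∈ LL p ν k := fun y hy =>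
    smul_mem_LL k hp.two_le (i₀, ⟨0, by have := hp.two_le; omega⟩) hint hrho hy
  have hcard := relIndex_LL_dual_LL k hp.two_le hi hint hww
  refine ⟨hsmul, hcard, nonempty_addEquiv_of_card p ν (fun g => ?_) hcard⟩
  induction g using QuotientAddGroup.induction_on with
  | H y =>
    rw [← QuotientAddGroup.mk_nsmul, QuotientAddGroup.eq_zero_iff, AddSubgroup.mem_addSubgroupOf]
    simpa using hsmul y y.2
end

section
/- There exists a group G of isometries of the K3 lattice Λ, isomorphic to the alternating group A_4, such that: (a) the fixed sublattice Λ^G := {x ∈ Λ : g·x = x for all g ∈ G} is spanned by four pairwise orthogonal vectors each of self-intersection −4 (in particular Λ^G contains no vector of self-intersection −2); and (b) the orthogonal complement W of Λ^G ⊗ ℝ in Λ ⊗ ℝ contains a G-invariant 3-dimensional subspace P on which the form is positive definite, and W is, as a real representation of G, isomorphic to the direct sum of six copies of P. -/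
open scoped BigOperators

/-- The Cartan matrix of `E8` (nodes `0,…,6` a chain, node `7` attached to node `2`). -/
def cartanE8 (i j : Fin 8) : ℤ :=
  if i = j then 2
  else if (i.1, j.1) ∈ [(0,1),(1,2),(2,3),(3,4),(4,5),(5,6),(2,7)] ∨
      (j.1, i.1) ∈ [(0,1),(1,2),(2,3),(3,4),(4,5),(5,6),(2,7)] then -1
  else 0

/-- The Gram matrix of the K3 lattice `U ⊕ U ⊕ U ⊕ (−E8) ⊕ (−E8)` on `ℤ^22`. -/
def gramK3 (i j : Fin 22) : ℤ :=
  if i.1 < 6 ∧ j.1 < 6 then (if i.1 / 2 = j.1 / 2 ∧ i.1 ≠ j.1 then 1 else 0)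
  else if h : 6 ≤ i.1 ∧ i.1 < 14 ∧ 6 ≤ j.1 ∧ j.1 < 14 then
    -(cartanE8 ⟨i.1 - 6, by omega⟩ ⟨j.1 - 6, by omega⟩)
  else if h' : 14 ≤ i.1 ∧ 14 ≤ j.1 then
    -(cartanE8 ⟨i.1 - 14, by have := i.isLt; omega⟩ ⟨j.1 - 14, by have := j.isLt; omega⟩)
  else 0

/-- The bilinear form of the K3 lattice on `ℤ^22`. -/
def BK3 : (Fin 22 → ℤ) →ₗ[ℤ] (Fin 22 → ℤ) →ₗ[ℤ] ℤ :=
  LinearMap.mk₂ ℤ (fun x y => ∑ a, ∑ b, x a * gramK3 a b * y b)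
    (by
      intro x x' y
      rw [← Finset.sum_add_distrib]
      refine Finset.sum_congr rfl fun a _ => ?_
      rw [← Finset.sum_add_distrib]
      refine Finset.sum_congr rfl fun b _ => ?_
      simp only [Pi.add_apply]; ring)
    (by
      intro c x y
      rw [Finset.smul_sum]
      refine Finset.sum_congr rfl fun a _ => ?_
      rw [Finset.smul_sum]
      refine Finset.sum_congr rfl fun b _ => ?_
      simp only [Pi.smul_apply, smul_eq_mul]; ring)
    (by
      intro x y y'
      rw [← Finset.sum_add_distrib]
      refine Finset.sum_congr rfl fun a _ => ?_
      rw [← Finset.sum_add_distrib]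
      refine Finset.sum_congr rfl fun b _ => ?_
      simp only [Pi.add_apply]; ring)
    (by
      intro c x y
      rw [Finset.smul_sum]
      refine Finset.sum_congr rfl fun a _ => ?_
      rw [Finset.smul_sum]
      refine Finset.sum_congr rfl fun b _ => ?_
      simp only [Pi.smul_apply, smul_eq_mul]; ring)

/-- The `ℝ`-bilinear extension of the K3 lattice form to `ℝ^22 = Λ ⊗ ℝ`. -/
def BK3R : (Fin 22 → ℝ) →ₗ[ℝ] (Fin 22 → ℝ) →ₗ[ℝ] ℝ :=
  LinearMap.mk₂ ℝ (fun x y => ∑ a, ∑ b, x a * (gramK3 a b : ℝ) * y b)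
    (by
      intro x x' y
      rw [← Finset.sum_add_distrib]
      refine Finset.sum_congr rfl fun a _ => ?_
      rw [← Finset.sum_add_distrib]
      refine Finset.sum_congr rfl fun b _ => ?_
      simp only [Pi.add_apply]; ring)
    (by
      intro c x y
      rw [Finset.smul_sum]
      refine Finset.sum_congr rfl fun a _ => ?_
      rw [Finset.smul_sum]
      refine Finset.sum_congr rfl fun b _ => ?_
      simp only [Pi.smul_apply, smul_eq_mul]; ring)
    (by
      intro x y y'
      rw [← Finset.sum_add_distrib]
      refine Finset.sum_congr rfl fun a _ => ?_
      rw [← Finset.sum_add_distrib]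
      refine Finset.sum_congr rfl fun b _ => ?_
      simp only [Pi.add_apply]; ring)
    (by
      intro c x y
      rw [Finset.smul_sum]
      refine Finset.sum_congr rfl fun a _ => ?_
      rw [Finset.smul_sum]
      refine Finset.sum_congr rfl fun b _ => ?_
      simp only [Pi.smul_apply, smul_eq_mul]; ring)

/-- The `ℝ`-linear extension of a `ℤ`-linear endomorphism of `ℤ^22` to `ℝ^22`. -/
noncomputable def extR (f : (Fin 22 → ℤ) →ₗ[ℤ] (Fin 22 → ℤ)) :
    (Fin 22 → ℝ) →ₗ[ℝ] (Fin 22 → ℝ) :=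
  Matrix.toLin' (Matrix.of fun i j => ((f (Pi.single j 1) i : ℤ) : ℝ))

/-- The canonical map `Λ → Λ ⊗ ℝ`. -/
def realify (x : Fin 22 → ℤ) : Fin 22 → ℝ := fun i => (x i : ℝ)

namespace TetrahedralK3

open Matrix
open scoped Kronecker

/-- Eighteen lattice vectors spanning the complement `W` rationally; each consecutive triple spans a
copy of the three-dimensional representation. -/
def isotypicVectors : Matrix (Fin 18) (Fin 22) ℤ :=
  !![-3, -6, 0, -6, 0, -6, -10, -20, -30, -24, -18, -12, -6, -16, 0, 0, 0, 0, 0, 0, 0, 0;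
     -3, -6, 0, -6, 6, 0, 0, 0, 0, 0, 0, 0, 0, 0, -10, -20, -30, -24, -18, -12, -6, -16;
     -1, -2, 2, 0, 0, 0, 0, 0, 0, 0, 0, 0, 0, 0, 0, 0, 0, 0, 0, 0, 0, 0;
     1, 2, 0, 2, -2, 2, 0, 0, 0, 0, 0, 0, 0, 0, 0, 0, 0, 0, 0, 0, 0, 0;
     1, 2, -2, 2, 0, 0, 0, 0, 0, 0, 0, 0, 0, 0, 0, 0, 0, 0, 0, 0, 0, 0;
     1, -2, 0, 0, 0, 0, 0, 0, 0, 0, 0, 0, 0, 0, 0, 0, 0, 0, 0, 0, 0, 0;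
     0, 0, 0, 0, 0, 0, 1, 2, 1, 0, 0, 0, 0, 0, 0, 0, 0, 0, 0, 0, 0, 0;
     0, 0, 0, 0, 0, 0, 1, 0, 1, 0, 0, 0, 0, 0, 0, 0, 0, 0, 0, 0, 0, 0;
     0, 0, 0, 0, 0, 0, 1, 0, -1, 0, 0, 0, 0, 0, 0, 0, 0, 0, 0, 0, 0, 0;
     0, 0, 0, 0, 0, 0, 0, 0, 0, 0, 1, 2, 1, 0, 0, 0, 0, 0, 0, 0, 0, 0;
     0, 0, 0, 0, 0, 0, 0, 0, 0, 0, 1, 0, 1, 0, 0, 0, 0, 0, 0, 0, 0, 0;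
     0, 0, 0, 0, 0, 0, 0, 0, 0, 0, 1, 0, -1, 0, 0, 0, 0, 0, 0, 0, 0, 0;
     0, 0, 0, 0, 0, 0, 0, 0, 0, 0, 0, 0, 0, 0, 1, 2, 1, 0, 0, 0, 0, 0;
     0, 0, 0, 0, 0, 0, 0, 0, 0, 0, 0, 0, 0, 0, 1, 0, 1, 0, 0, 0, 0, 0;
     0, 0, 0, 0, 0, 0, 0, 0, 0, 0, 0, 0, 0, 0, 1, 0, -1, 0, 0, 0, 0, 0;
     0, 0, 0, 0, 0, 0, 0, 0, 0, 0, 0, 0, 0, 0, 0, 0, 0, 0, 1, 2, 1, 0;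
     0, 0, 0, 0, 0, 0, 0, 0, 0, 0, 0, 0, 0, 0, 0, 0, 0, 0, 1, 0, 1, 0;
     0, 0, 0, 0, 0, 0, 0, 0, 0, 0, 0, 0, 0, 0, 0, 0, 0, 0, 1, 0, -1, 0]

/-- Four orthogonal `(-4)`-vectors, a basis of the fixed lattice. -/
def fixedVectors : Matrix (Fin 4) (Fin 22) ℤ :=
  !![-2, -4, 0, -4, 0, -4, -7, -14, -21, -16, -12, -8, -4, -12, 0, 0, 0, 0, 0, 0, 0, 0;
     -2, -4, 0, -4, 0, -4, -8, -16, -24, -20, -15, -10, -5, -12, 0, 0, 0, 0, 0, 0, 0, 0;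
     -2, -4, 0, -4, 4, 0, 0, 0, 0, 0, 0, 0, 0, 0, -7, -14, -21, -16, -12, -8, -4, -12;
     -2, -4, 0, -4, 4, 0, 0, 0, 0, 0, 0, 0, 0, 0, -8, -16, -24, -20, -15, -10, -5, -12]

/-- The linear forms dual, up to the factor `4`, to `isotypicVectors`. -/
def isotypicCoordinates : Matrix (Fin 18) (Fin 22) ℤ :=
  !![-6, -3, -6, 0, -6, 0, 0, 0, 0, 0, 0, 0, 0, 2, 0, 0, 0, 0, 0, 0, 0, 0;
     -6, -3, -6, 0, 0, 6, 0, 0, 0, 0, 0, 0, 0, 0, 0, 0, 0, 0, 0, 0, 0, 2;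
     -2, -1, 0, 2, 0, 0, 0, 0, 0, 0, 0, 0, 0, 0, 0, 0, 0, 0, 0, 0, 0, 0;
     -2, -1, -2, 0, -2, 2, 0, 0, 0, 0, 0, 0, 0, 0, 0, 0, 0, 0, 0, 0, 0, 0;
     -2, -1, -2, 2, 0, 0, 0, 0, 0, 0, 0, 0, 0, 0, 0, 0, 0, 0, 0, 0, 0, 0;
     2, -1, 0, 0, 0, 0, 0, 0, 0, 0, 0, 0, 0, 0, 0, 0, 0, 0, 0, 0, 0, 0;
     0, 0, 0, 0, 0, 0, 0, 2, 0, -1, 0, 0, 0, -1, 0, 0, 0, 0, 0, 0, 0, 0;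
     0, 0, 0, 0, 0, 0, 2, -2, 2, -1, 0, 0, 0, -1, 0, 0, 0, 0, 0, 0, 0, 0;
     0, 0, 0, 0, 0, 0, 2, 0, -2, 1, 0, 0, 0, 1, 0, 0, 0, 0, 0, 0, 0, 0;
     0, 0, 0, 0, 0, 0, 0, 0, 0, -1, 0, 2, 0, 0, 0, 0, 0, 0, 0, 0, 0, 0;
     0, 0, 0, 0, 0, 0, 0, 0, 0, -1, 2, -2, 2, 0, 0, 0, 0, 0, 0, 0, 0, 0;
     0, 0, 0, 0, 0, 0, 0, 0, 0, -1, 2, 0, -2, 0, 0, 0, 0, 0, 0, 0, 0, 0;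
     0, 0, 0, 0, 0, 0, 0, 0, 0, 0, 0, 0, 0, 0, 0, 2, 0, -1, 0, 0, 0, -1;
     0, 0, 0, 0, 0, 0, 0, 0, 0, 0, 0, 0, 0, 0, 2, -2, 2, -1, 0, 0, 0, -1;
     0, 0, 0, 0, 0, 0, 0, 0, 0, 0, 0, 0, 0, 0, 2, 0, -2, 1, 0, 0, 0, 1;
     0, 0, 0, 0, 0, 0, 0, 0, 0, 0, 0, 0, 0, 0, 0, 0, 0, -1, 0, 2, 0, 0;
     0, 0, 0, 0, 0, 0, 0, 0, 0, 0, 0, 0, 0, 0, 0, 0, 0, -1, 2, -2, 2, 0;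
     0, 0, 0, 0, 0, 0, 0, 0, 0, 0, 0, 0, 0, 0, 0, 0, 0, -1, 2, 0, -2, 0]

/-- The linear forms dual, up to the factor `4`, to `fixedVectors`. -/
def fixedCoordinates : Matrix (Fin 4) (Fin 22) ℤ :=
  !![4, 2, 4, 0, 4, 0, 0, 0, 0, 1, 0, 0, 0, -3, 0, 0, 0, 0, 0, 0, 0, 0;
     4, 2, 4, 0, 4, 0, 0, 0, 0, -1, 0, 0, 0, 0, 0, 0, 0, 0, 0, 0, 0, 0;
     4, 2, 4, 0, 0, -4, 0, 0, 0, 0, 0, 0, 0, 0, 0, 0, 0, 1, 0, 0, 0, -3;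
     4, 2, 4, 0, 0, -4, 0, 0, 0, 0, 0, 0, 0, 0, 0, 0, 0, -1, 0, 0, 0, 0]

/-- Integral linear forms which agree on the fixed lattice with a quarter of `fixedCoordinates`. -/
def fixedIntegralCoordinates : Matrix (Fin 4) (Fin 22) ℤ :=
  !![4, 2, 4, 0, 4, 0, 1, 0, 0, 0, 0, 0, 0, -2, 0, 0, 0, 0, 0, 0, 0, 0;
     4, 2, 4, 0, 4, 0, 0, 0, 0, -1, 1, 0, 0, -1, 0, 0, 0, 0, 0, 0, 0, 0;
     4, 2, 4, 0, 3, -1, 0, 0, 0, 0, 0, 0, 0, -1, 1, 0, 0, 0, 0, 0, 0, -1;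
     4, 2, 4, 0, 3, -1, 0, 0, 0, 0, 0, 0, 0, -1, 0, 0, 0, -1, 1, 0, 0, 0]

/-- `isotypicVectors` as columns, indexed by copy and position inside the copy. -/
def wMat : Matrix (Fin 22) (Fin 6 × Fin 3) ℤ :=
  isotypicVectorsᵀ.submatrix id finProdFinEquiv

/-- `isotypicCoordinates`, indexed by copy and position inside the copy. -/
def cMat : Matrix (Fin 6 × Fin 3) (Fin 22) ℤ :=
  isotypicCoordinates.submatrix finProdFinEquiv id

/-- `fixedVectors` as columns. -/
def vMat : Matrix (Fin 22) (Fin 4) ℤ := fixedVectorsᵀ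

/-- Signs of the form on the isotypic coordinates: the first copy is positive definite. -/
def signMat : Matrix (Fin 6) (Fin 6) ℤ := diagonal fun m => if m = 0 then 1 else -1

/-- The nontrivial rows of the `4 × 4` Hadamard matrix. -/
def hadamard : Matrix (Fin 3) (Fin 4) ℤ :=
  !![1, 1, -1, -1; 1, -1, 1, -1; 1, -1, -1, 1]

/-- The tetrahedral representation of `A₄` by signed permutation matrices. -/
def tetra (g : alternatingGroup (Fin 4)) : Matrix (Fin 3) (Fin 3) ℤ :=
  of fun i j => (∑ k, hadamard i (g.1 k) * hadamard j k) / 4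

theorem tetra_one : tetra 1 = 1 := by decide +kernel

theorem tetra_mul : ∀ g h, tetra (g * h) = tetra g * tetra h := by decide +kernel

theorem tetra_transpose_mul : ∀ g, (tetra g)ᵀ * tetra g = 1 := by decide +kernel

theorem eq_one_of_tetra_eq_one : ∀ g, tetra g = 1 → g = 1 := by decide +kernel

theorem sum_tetra : ∑ g, tetra g = 0 := by decide +kernel

theorem cMat_mul_wMat : cMat * wMat = (4 : ℤ) • 1 := by decide +kernel

theorem cMat_mul_vMat : cMat * vMat = 0 := by decide +kernel

theorem fixedCoordinates_mul_wMat : fixedCoordinates * wMat = 0 := by decide +kernel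

theorem fixedCoordinates_mul_vMat : fixedCoordinates * vMat = (4 : ℤ) • 1 := by decide +kernel

theorem wMat_mul_cMat_add : wMat * cMat + vMat * fixedCoordinates = (4 : ℤ) • 1 := by
  decide +kernel

theorem gram_mul_wMat :
    of gramK3 * wMat = cMatᵀ * (signMat ⊗ₖ (1 : Matrix (Fin 3) (Fin 3) ℤ)) := by
  decide +kernel

theorem gram_mul_vMat : of gramK3 * vMat = -fixedCoordinatesᵀ := by decide +kernel

theorem fixedCoordinates_eq : fixedCoordinates = (4 : ℤ) • fixedIntegralCoordinates +
    (of fun (k : Fin 4) (p : Fin 6 × Fin 3) =>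
      if p.1.1 = k.1 + 2 then (-1 : ℤ) else if p = (0, 0) then 2 else 0) * cMat := by
  decide +kernel

/-- The block diagonal matrix acting by `M` on each triple of isotypic coordinates. -/
abbrev blocks (M : Matrix (Fin 3) (Fin 3) ℤ) : Matrix (Fin 6 × Fin 3) (Fin 6 × Fin 3) ℤ :=
  (1 : Matrix (Fin 6) (Fin 6) ℤ) ⊗ₖ M

/-- Some endomorphism of the lattice acts on each triple of isotypic coordinates through
`M` and fixes the fixed lattice. -/
def Integral (M : Matrix (Fin 3) (Fin 3) ℤ) : Prop :=
  ∃ R : Matrix (Fin 22) (Fin 22) ℤ,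
    (4 : ℤ) • R = wMat * blocks M * cMat + vMat * fixedCoordinates

theorem integral_of_dvd {M : Matrix (Fin 3) (Fin 3) ℤ}
    (h : ∀ i j, (4 : ℤ) ∣ (∑ m, ∑ k, wMat i (m, k) * ∑ l, M k l * cMat (m, l) j) +
      (vMat * fixedCoordinates) i j) : Integral M := by
  choose R hR using h
  refine ⟨of R, ?_⟩
  ext i j
  rw [Matrix.smul_apply, of_apply, smul_eq_mul, ← hR, Matrix.add_apply, Matrix.mul_assoc]
  congr 1
  simp [mul_apply, Fintype.sum_prod_type, one_apply, Finset.sum_ite_eq]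

/-- Rotation by `π` about a coordinate axis. -/
def halfTurn : Matrix (Fin 3) (Fin 3) ℤ := !![1, 0, 0; 0, -1, 0; 0, 0, -1]

/-- Cyclic permutation of the coordinate axes. -/
def thirdTurn : Matrix (Fin 3) (Fin 3) ℤ := !![0, 1, 0; 0, 0, 1; 1, 0, 0]

theorem integral_halfTurn : Integral halfTurn := integral_of_dvd (by decide +kernel)

theorem integral_thirdTurn : Integral thirdTurn := integral_of_dvd (by decide +kernel)

theorem tetra_eq : ∀ g, ∃ i j : Fin 3, tetra g = thirdTurn ^ (i : ℕ) * thirdTurn ^ (j : ℕ) ∨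
    tetra g = thirdTurn ^ (i : ℕ) * (halfTurn * thirdTurn ^ (j : ℕ)) := by
  decide +kernel

theorem blocks_mul (M N : Matrix (Fin 3) (Fin 3) ℤ) : blocks (M * N) = blocks M * blocks N := by
  rw [blocks, blocks, blocks, ← mul_kronecker_mul, Matrix.one_mul]

theorem blocks_one : blocks 1 = 1 := one_kronecker_one

theorem blocks_injective : Function.Injective blocks := by
  intro M N h
  ext i j
  simpa using congrFun (congrFun h (0, i)) (0, j)

theorem smul_four_injective {m n : Type*} :
    Function.Injective fun A : Matrix m n ℤ => (4 : ℤ) • A :=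
  fun _ _ h => Matrix.ext fun i j =>
    mul_left_cancel₀ (by norm_num : (4 : ℤ) ≠ 0) (congrFun (congrFun h i) j)

theorem cMat_mul_of_smul_eq {M : Matrix (Fin 3) (Fin 3) ℤ} {R : Matrix (Fin 22) (Fin 22) ℤ}
    (h : (4 : ℤ) • R = wMat * blocks M * cMat + vMat * fixedCoordinates) :
    cMat * R = blocks M * cMat := by
  apply smul_four_injective
  simp only
  rw [← Matrix.mul_smul, h, Matrix.mul_add, ← Matrix.mul_assoc, ← Matrix.mul_assoc,
    ← Matrix.mul_assoc, cMat_mul_wMat, cMat_mul_vMat]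
  simp only [Matrix.smul_mul, Matrix.one_mul, Matrix.zero_mul, add_zero]

theorem fixedCoordinates_mul_of_smul_eq
    {M : Matrix (Fin 3) (Fin 3) ℤ} {R : Matrix (Fin 22) (Fin 22) ℤ}
    (h : (4 : ℤ) • R = wMat * blocks M * cMat + vMat * fixedCoordinates) :
    fixedCoordinates * R = fixedCoordinates := by
  apply smul_four_injective
  simp only
  rw [← Matrix.mul_smul, h, Matrix.mul_add, ← Matrix.mul_assoc, ← Matrix.mul_assoc,
    ← Matrix.mul_assoc, fixedCoordinates_mul_wMat, fixedCoordinates_mul_vMat]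
  simp only [Matrix.smul_mul, Matrix.one_mul, Matrix.zero_mul, zero_add]

theorem mul_wMat_of_smul_eq {M : Matrix (Fin 3) (Fin 3) ℤ} {R : Matrix (Fin 22) (Fin 22) ℤ}
    (h : (4 : ℤ) • R = wMat * blocks M * cMat + vMat * fixedCoordinates) :
    R * wMat = wMat * blocks M := by
  apply smul_four_injective
  simp only
  rw [← Matrix.smul_mul, h, Matrix.add_mul, Matrix.mul_assoc, Matrix.mul_assoc vMat,
    cMat_mul_wMat, fixedCoordinates_mul_wMat]
  simp only [Matrix.mul_smul, Matrix.mul_one, Matrix.mul_zero, add_zero]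

theorem mul_vMat_of_smul_eq {M : Matrix (Fin 3) (Fin 3) ℤ} {R : Matrix (Fin 22) (Fin 22) ℤ}
    (h : (4 : ℤ) • R = wMat * blocks M * cMat + vMat * fixedCoordinates) :
    R * vMat = vMat := by
  apply smul_four_injective
  simp only
  rw [← Matrix.smul_mul, h, Matrix.add_mul, Matrix.mul_assoc, Matrix.mul_assoc vMat,
    cMat_mul_vMat, fixedCoordinates_mul_vMat]
  simp only [Matrix.mul_smul, Matrix.mul_one, Matrix.mul_zero, zero_add]

/-- The isotypic and fixed coordinates jointly separate lattice endomorphisms. -/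
theorem eq_of_coordinates_mul_eq {A B : Matrix (Fin 22) (Fin 22) ℤ}
    (hc : cMat * A = cMat * B) (hf : fixedCoordinates * A = fixedCoordinates * B) : A = B := by
  apply smul_four_injective
  have key (C : Matrix (Fin 22) (Fin 22) ℤ) :
      (4 : ℤ) • C = wMat * (cMat * C) + vMat * (fixedCoordinates * C) := by
    rw [← Matrix.mul_assoc, ← Matrix.mul_assoc, ← Matrix.add_mul, wMat_mul_cMat_add]
    simp
  simp only [key, hc, hf]

theorem Integral.mul {M N : Matrix (Fin 3) (Fin 3) ℤ} (hM : Integral M) (hN : Integral N) :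
    Integral (M * N) := by
  obtain ⟨R, hR⟩ := hM
  obtain ⟨S, hS⟩ := hN
  refine ⟨R * S, ?_⟩
  rw [← Matrix.smul_mul, hR, Matrix.add_mul, Matrix.mul_assoc, cMat_mul_of_smul_eq hS,
    Matrix.mul_assoc vMat, fixedCoordinates_mul_of_smul_eq hS]
  rw [blocks_mul]
  simp only [Matrix.mul_assoc]

theorem integral_one : Integral 1 :=
  ⟨1, by rw [blocks_one, Matrix.mul_one, wMat_mul_cMat_add]⟩

theorem Integral.pow {M : Matrix (Fin 3) (Fin 3) ℤ} (hM : Integral M) (n : ℕ) :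
    Integral (M ^ n) := by
  induction n with
  | zero => simpa using integral_one
  | succ n ih => simpa [pow_succ] using ih.mul hM

theorem integral_tetra (g : alternatingGroup (Fin 4)) : Integral (tetra g) := by
  obtain ⟨i, j, h | h⟩ := tetra_eq g
  · exact h ▸ (integral_thirdTurn.pow i).mul (integral_thirdTurn.pow j)
  · exact h ▸ (integral_thirdTurn.pow i).mul (integral_halfTurn.mul (integral_thirdTurn.pow j))

/-- The matrices of the action of `A₄` on the K3 lattice. -/
noncomputable def actionMat (g : alternatingGroup (Fin 4)) : Matrix (Fin 22) (Fin 22) ℤ :=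
  (integral_tetra g).choose

theorem smul_actionMat (g : alternatingGroup (Fin 4)) :
    (4 : ℤ) • actionMat g = wMat * blocks (tetra g) * cMat + vMat * fixedCoordinates :=
  (integral_tetra g).choose_spec

theorem cMat_mul_actionMat (g : alternatingGroup (Fin 4)) :
    cMat * actionMat g = blocks (tetra g) * cMat :=
  cMat_mul_of_smul_eq (smul_actionMat g)

theorem fixedCoordinates_mul_actionMat (g : alternatingGroup (Fin 4)) :
    fixedCoordinates * actionMat g = fixedCoordinates :=
  fixedCoordinates_mul_of_smul_eq (smul_actionMat g)

theorem actionMat_mul_wMat (g : alternatingGroup (Fin 4)) :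
    actionMat g * wMat = wMat * blocks (tetra g) :=
  mul_wMat_of_smul_eq (smul_actionMat g)

theorem actionMat_mul_vMat (g : alternatingGroup (Fin 4)) : actionMat g * vMat = vMat :=
  mul_vMat_of_smul_eq (smul_actionMat g)

/-- `actionMat` as a representation. -/
noncomputable def actionMatHom : alternatingGroup (Fin 4) →* Matrix (Fin 22) (Fin 22) ℤ where
  toFun := actionMat
  map_one' := eq_of_coordinates_mul_eq
    (by rw [cMat_mul_actionMat, tetra_one, blocks_one, Matrix.one_mul, Matrix.mul_one])
    (by rw [fixedCoordinates_mul_actionMat, Matrix.mul_one])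
  map_mul' g h := eq_of_coordinates_mul_eq
    (by rw [cMat_mul_actionMat, ← Matrix.mul_assoc, cMat_mul_actionMat, Matrix.mul_assoc,
      cMat_mul_actionMat, tetra_mul, blocks_mul, Matrix.mul_assoc])
    (by simp only [← Matrix.mul_assoc, fixedCoordinates_mul_actionMat])

/-- The action of `A₄` on the K3 lattice. -/
noncomputable def action :
    alternatingGroup (Fin 4) →* ((Fin 22 → ℤ) ≃ₗ[ℤ] (Fin 22 → ℤ)) :=
  (LinearMap.GeneralLinearGroup.generalLinearEquiv ℤ (Fin 22 → ℤ)).toMonoidHom.comp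
    ((toLinAlgEquiv' : Matrix (Fin 22) (Fin 22) ℤ ≃ₐ[ℤ] _).toAlgHom.toMonoidHom.comp
      actionMatHom).toHomUnits

theorem action_apply (g : alternatingGroup (Fin 4)) (x : Fin 22 → ℤ) :
    action g x = actionMat g *ᵥ x := rfl

theorem action_injective : Function.Injective action := by
  rw [injective_iff_map_eq_one]
  intro g hg
  have h1 : actionMat g = 1 := by
    refine Matrix.ext_of_mulVec_single fun j => ?_
    rw [← action_apply, hg, Matrix.one_mulVec]
    rfl
  refine eq_one_of_tetra_eq_one g (blocks_injective (smul_four_injective ?_))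
  have h2 := actionMat_mul_wMat g
  rw [h1, Matrix.one_mul] at h2
  have h3 := congrArg (cMat * ·) h2
  simp only [← Matrix.mul_assoc, cMat_mul_wMat] at h3
  simpa [blocks_one] using h3.symm

/-- The Gram matrix is block diagonal in the isotypic and fixed coordinates. -/
theorem smul_gram : (4 : ℤ) • of gramK3 =
    cMatᵀ * (signMat ⊗ₖ (1 : Matrix (Fin 3) (Fin 3) ℤ)) * cMat -
      fixedCoordinatesᵀ * fixedCoordinates := by
  rw [← gram_mul_wMat, sub_eq_add_neg, ← Matrix.neg_mul, ← gram_mul_vMat, Matrix.mul_assoc,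
    Matrix.mul_assoc, ← Matrix.mul_add, wMat_mul_cMat_add, Matrix.mul_smul,
    Matrix.mul_one]

theorem BK3_apply (x y : Fin 22 → ℤ) : BK3 x y = x ⬝ᵥ of gramK3 *ᵥ y := by
  simp [BK3, dotProduct, mulVec, Finset.mul_sum, mul_assoc]

theorem BK3R_apply (x y : Fin 22 → ℝ) :
    BK3R x y = x ⬝ᵥ (of gramK3).map (Int.castRingHom ℝ) *ᵥ y := by
  simp [BK3R, dotProduct, mulVec, Finset.mul_sum, mul_assoc]

theorem transpose_actionMat_mul_gram_mul (g : alternatingGroup (Fin 4)) :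
    (actionMat g)ᵀ * of gramK3 * actionMat g = of gramK3 := by
  have hb : (blocks (tetra g))ᵀ * (signMat ⊗ₖ (1 : Matrix (Fin 3) (Fin 3) ℤ)) *
      blocks (tetra g) = signMat ⊗ₖ (1 : Matrix (Fin 3) (Fin 3) ℤ) := by
    rw [blocks, ← kroneckerMap_transpose, ← mul_kronecker_mul, ← mul_kronecker_mul,
      Matrix.mul_one, Matrix.mul_one, tetra_transpose_mul, transpose_one, Matrix.one_mul]
  apply smul_four_injective
  simp only
  rw [← Matrix.smul_mul, ← Matrix.mul_smul, smul_gram, Matrix.mul_sub, Matrix.sub_mul]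
  congr 1
  · calc _ = (cMat * actionMat g)ᵀ * (signMat ⊗ₖ (1 : Matrix (Fin 3) (Fin 3) ℤ)) *
          (cMat * actionMat g) := by simp only [transpose_mul, Matrix.mul_assoc]
      _ = cMatᵀ * ((blocks (tetra g))ᵀ * (signMat ⊗ₖ (1 : Matrix (Fin 3) (Fin 3) ℤ)) *
          blocks (tetra g)) * cMat := by
        rw [cMat_mul_actionMat]; simp only [transpose_mul, Matrix.mul_assoc]
      _ = _ := by rw [hb]
  · calc _ = (fixedCoordinates * actionMat g)ᵀ * (fixedCoordinates * actionMat g) := by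
          simp only [transpose_mul, Matrix.mul_assoc]
      _ = _ := by rw [fixedCoordinates_mul_actionMat]

theorem BK3_action (g : alternatingGroup (Fin 4)) (x y : Fin 22 → ℤ) :
    BK3 (action g x) (action g y) = BK3 x y := by
  rw [BK3_apply, BK3_apply, action_apply, action_apply, ← vecMul_transpose, ← dotProduct_mulVec,
    mulVec_mulVec, mulVec_mulVec, transpose_actionMat_mul_gram_mul]

theorem transpose_vMat_mul_gram : vMatᵀ * of gramK3 * vMat = (-4 : ℤ) • 1 := by
  rw [Matrix.mul_assoc, gram_mul_vMat, Matrix.mul_neg, ← transpose_mul, fixedCoordinates_mul_vMat]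
  simp

theorem BK3_mulVec_vMat (x y : Fin 4 → ℤ) :
    BK3 (vMat *ᵥ x) (vMat *ᵥ y) = -4 * (x ⬝ᵥ y) := by
  rw [BK3_apply, ← vecMul_transpose, ← dotProduct_mulVec, mulVec_mulVec, mulVec_mulVec,
    transpose_vMat_mul_gram, smul_mulVec, one_mulVec, dotProduct_smul, smul_eq_mul]

theorem cMat_mulVec_eq_zero {x : Fin 22 → ℤ} (hx : ∀ g, action g x = x) : cMat *ᵥ x = 0 := by
  have h1 (g) : blocks (tetra g) *ᵥ (cMat *ᵥ x) = cMat *ᵥ x := by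
    rw [mulVec_mulVec, ← cMat_mul_actionMat, ← mulVec_mulVec, ← action_apply, hx]
  have h2 : ∑ g, blocks (tetra g) = 0 := by
    ext p q
    have := congrFun (congrFun sum_tetra p.2) q.2
    simp only [Matrix.sum_apply, kroneckerMap_apply] at this ⊢
    rw [← Finset.mul_sum, this]
    simp
  have h3 := Finset.sum_congr (rfl : (Finset.univ : Finset (alternatingGroup (Fin 4))) = _)
    fun g _ => h1 g
  rw [← sum_mulVec, h2, zero_mulVec, Finset.sum_const] at h3
  exact (smul_eq_zero.1 h3.symm).resolve_left (Finset.card_ne_zero.2 Finset.univ_nonempty)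

theorem forall_action_eq_iff (x : Fin 22 → ℤ) :
    (∀ g, action g x = x) ↔ ∃ z, vMat *ᵥ z = x := by
  constructor
  · intro hx
    have hc := cMat_mulVec_eq_zero hx
    refine ⟨fixedIntegralCoordinates *ᵥ x, ?_⟩
    have h1 : fixedCoordinates *ᵥ x = (4 : ℤ) • fixedIntegralCoordinates *ᵥ x := by
      conv_lhs => rw [fixedCoordinates_eq]
      rw [add_mulVec, ← mulVec_mulVec, hc, mulVec_zero, add_zero, smul_mulVec]
    have h2 := congrArg (· *ᵥ x) wMat_mul_cMat_add
    simp only [add_mulVec, ← mulVec_mulVec, hc, h1, mulVec_zero, zero_add, smul_mulVec,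
      one_mulVec, mulVec_smul] at h2
    exact smul_right_injective _ (by norm_num : (4 : ℤ) ≠ 0) h2
  · rintro ⟨z, rfl⟩ g
    rw [action_apply, mulVec_mulVec, actionMat_mul_vMat]

/-- The extension of an integral matrix to the reals. -/
abbrev real {m n : Type*} (A : Matrix m n ℤ) : Matrix m n ℝ := A.map (Int.castRingHom ℝ)

theorem real_apply {m n : Type*} (A : Matrix m n ℤ) (i : m) (j : n) : real A i j = (A i j : ℝ) :=
  rfl

theorem real_mul {l m n : Type*} [Fintype m] (A : Matrix l m ℤ) (B : Matrix m n ℤ) :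
    real (A * B) = real A * real B := Matrix.map_mul

theorem real_smul_one {n : Type*} [DecidableEq n] (c : ℤ) :
    real (c • (1 : Matrix n n ℤ)) = (c : ℝ) • 1 := by
  ext i j
  rw [real_apply, Matrix.smul_apply, Matrix.smul_apply, one_apply, one_apply]
  split_ifs <;> simp

theorem realify_mulVec {m : Type*} [Fintype m] (A : Matrix (Fin 22) m ℤ) (z : m → ℤ) :
    realify (A *ᵥ z) = real A *ᵥ fun k => (z k : ℝ) := by
  ext i
  simp [realify, mulVec, dotProduct]

theorem extR_action (g : alternatingGroup (Fin 4)) (y : Fin 22 → ℝ) :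
    extR (action g).toLinearMap y = real (actionMat g) *ᵥ y := by
  rw [extR, toLin'_apply]
  congr 1
  ext i j
  simp [action_apply]

theorem BK3R_mulVec_vMat (y : Fin 22 → ℝ) (z : Fin 4 → ℤ) :
    BK3R y (realify (vMat *ᵥ z)) = -((real fixedCoordinates *ᵥ y) ⬝ᵥ fun k => (z k : ℝ)) := by
  have h : real (of gramK3) * real vMat = -(real fixedCoordinates)ᵀ := by
    rw [← real_mul, gram_mul_vMat]
    ext i j
    simp
  rw [BK3R_apply, realify_mulVec, mulVec_mulVec, h, neg_mulVec, dotProduct_neg,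
    dotProduct_mulVec, vecMul_transpose]

/-- The orthogonal complement of the fixed lattice. -/
noncomputable def complement : Submodule ℝ (Fin 22 → ℝ) :=
  LinearMap.ker (toLin' (real fixedCoordinates))

theorem mem_complement {y : Fin 22 → ℝ} : y ∈ complement ↔ real fixedCoordinates *ᵥ y = 0 := by
  rw [complement, LinearMap.mem_ker, toLin'_apply]

theorem complement_eq : complement = ⨅ x : {x : Fin 22 → ℤ // ∀ g, action g x = x},
    LinearMap.ker (BK3R.flip (realify x.1)) := by
  ext y
  simp only [mem_complement, Submodule.mem_iInf, LinearMap.mem_ker, LinearMap.flip_apply]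
  constructor
  · rintro h ⟨x, hx⟩
    obtain ⟨z, rfl⟩ := (forall_action_eq_iff x).1 hx
    rw [BK3R_mulVec_vMat, h, zero_dotProduct, neg_zero]
  · intro h
    ext k
    have hk := h ⟨vMat *ᵥ Pi.single k 1, (forall_action_eq_iff _).2 ⟨_, rfl⟩⟩
    rw [BK3R_mulVec_vMat, neg_eq_zero] at hk
    simpa [dotProduct, Pi.single_apply] using hk

theorem extR_action_mem_complement (g : alternatingGroup (Fin 4)) {y : Fin 22 → ℝ}
    (hy : y ∈ complement) : extR (action g).toLinearMap y ∈ complement := by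
  rw [mem_complement] at hy ⊢
  rw [extR_action, mulVec_mulVec, ← real_mul, fixedCoordinates_mul_actionMat, hy]

theorem real_cMat_mul_wMat : real cMat * real wMat = (4 : ℝ) • 1 := by
  rw [← real_mul, cMat_mul_wMat, real_smul_one]
  norm_num

/-- The isotypic coordinates of the complement of the fixed lattice. -/
noncomputable def complementEquiv : complement ≃ₗ[ℝ] (Fin 6 × Fin 3 → ℝ) where
  toFun y := real cMat *ᵥ y
  map_add' y z := mulVec_add _ _ _
  map_smul' c y := mulVec_smul _ _ _
  invFun z := ⟨(4 : ℝ)⁻¹ • real wMat *ᵥ z, by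
    rw [mem_complement, mulVec_smul, mulVec_mulVec, ← real_mul, fixedCoordinates_mul_wMat]
    simp⟩
  left_inv y := by
    have h := congrArg (real · *ᵥ (y : Fin 22 → ℝ)) wMat_mul_cMat_add
    have h' : real (wMat * cMat + vMat * fixedCoordinates) =
        real wMat * real cMat + real vMat * real fixedCoordinates := by
      rw [← real_mul, ← real_mul]
      exact Matrix.map_add _ (map_add _) _ _
    simp only [h', real_smul_one, add_mulVec, ← mulVec_mulVec, mem_complement.1 y.2, mulVec_zero,
      add_zero, smul_mulVec, one_mulVec] at h
    ext1
    simp only [h]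
    simp
  right_inv z := by
    simp only
    rw [mulVec_smul, mulVec_mulVec, real_cMat_mul_wMat, smul_mulVec, one_mulVec, smul_smul]
    norm_num

/-- The columns of `wMat` spanning the positive definite copy. -/
noncomputable def planeMat : Matrix (Fin 22) (Fin 3) ℝ :=
  (real wMat).submatrix id fun k => (0, k)

theorem actionMat_mul_planeMat (g : alternatingGroup (Fin 4)) :
    real (actionMat g) * planeMat = planeMat * real (tetra g) := by
  have h : real (actionMat g) * real wMat = real wMat * real (blocks (tetra g)) := by
    rw [← real_mul, ← real_mul, actionMat_mul_wMat]
  ext i j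
  have h' := congrFun (congrFun h i) (0, j)
  rw [mul_apply, mul_apply, Fintype.sum_prod_type_right] at h'
  simpa [mul_apply, planeMat, one_apply] using h'

theorem transpose_planeMat_mul_gram_mul :
    planeMatᵀ * real (of gramK3) * planeMat = (4 : ℝ) • 1 := by
  have h : wMatᵀ * of gramK3 * wMat =
      (4 : ℤ) • (signMat ⊗ₖ (1 : Matrix (Fin 3) (Fin 3) ℤ)) := by
    rw [Matrix.mul_assoc, gram_mul_wMat, ← Matrix.mul_assoc, ← transpose_mul, cMat_mul_wMat,
      transpose_smul, transpose_one, Matrix.smul_mul, Matrix.one_mul]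
  have h' : (real wMat)ᵀ * real (of gramK3) * real wMat =
      real ((4 : ℤ) • (signMat ⊗ₖ (1 : Matrix (Fin 3) (Fin 3) ℤ))) := by
    rw [← h, real_mul, real_mul]
    rfl
  have h2 := congrArg (fun A => A.submatrix (fun k : Fin 3 => (0, k)) fun k => (0, k)) h'
  refine h2.trans ?_
  ext i j
  rw [submatrix_apply, real_apply, Matrix.smul_apply, Matrix.smul_apply, kroneckerMap_apply,
    one_apply, one_apply]
  split_ifs <;> simp [signMat]

theorem BK3R_planeMat (z : Fin 3 → ℝ) :
    BK3R (planeMat *ᵥ z) (planeMat *ᵥ z) = 4 * (z ⬝ᵥ z) := by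
  rw [BK3R_apply, mulVec_mulVec, ← vecMul_transpose, ← dotProduct_mulVec, mulVec_mulVec,
    ← Matrix.mul_assoc,
    transpose_planeMat_mul_gram_mul, smul_mulVec, one_mulVec, dotProduct_smul, smul_eq_mul]

theorem planeMat_injective : Function.Injective (toLin' planeMat) := by
  rw [injective_iff_map_eq_zero]
  intro z hz
  have h := BK3R_planeMat z
  rw [← toLin'_apply, hz, map_zero, eq_comm, mul_eq_zero, dotProduct_self_eq_zero] at h
  exact h.resolve_left (by norm_num)

/-- The positive definite invariant subspace. -/
noncomputable def plane : Submodule ℝ (Fin 22 → ℝ) := LinearMap.range (toLin' planeMat)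

/-- The coordinates on `plane`. -/
noncomputable def planeEquiv : (Fin 3 → ℝ) ≃ₗ[ℝ] plane :=
  LinearEquiv.ofInjective _ planeMat_injective

theorem plane_le_complement : plane ≤ complement := by
  rintro _ ⟨z, rfl⟩
  have h : real fixedCoordinates * planeMat = 0 := by
    have h' : real fixedCoordinates * real wMat = 0 := by
      rw [← real_mul, fixedCoordinates_mul_wMat]
      ext i j
      simp
    ext i j
    exact congrFun (congrFun h' i) (0, j)
  rw [mem_complement, toLin'_apply, mulVec_mulVec, h, zero_mulVec]

theorem extR_action_planeMat (g : alternatingGroup (Fin 4)) (z : Fin 3 → ℝ) :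
    extR (action g).toLinearMap (planeMat *ᵥ z) = planeMat *ᵥ (real (tetra g) *ᵥ z) := by
  rw [extR_action, mulVec_mulVec, actionMat_mul_planeMat, mulVec_mulVec]

/-- The complement of the fixed lattice as a sum of six copies of `plane`. -/
noncomputable def complementEquivPlane : complement ≃ₗ[ℝ] (Fin 6 → plane) :=
  complementEquiv.trans ((LinearEquiv.curry ℝ ℝ (Fin 6) (Fin 3)).trans
    (LinearEquiv.piCongrRight fun _ => planeEquiv))

theorem coe_complementEquivPlane (y : complement) (m : Fin 6) :
    (complementEquivPlane y m : Fin 22 → ℝ) =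
      planeMat *ᵥ fun k => (real cMat *ᵥ (y : Fin 22 → ℝ)) (m, k) := rfl

theorem real_cMat_mulVec_extR_action (g : alternatingGroup (Fin 4)) (y : Fin 22 → ℝ) (m : Fin 6) :
    (fun k => (real cMat *ᵥ extR (action g).toLinearMap y) (m, k)) =
      real (tetra g) *ᵥ fun k => (real cMat *ᵥ y) (m, k) := by
  rw [extR_action, mulVec_mulVec, ← real_mul, cMat_mul_actionMat, real_mul, ← mulVec_mulVec]
  generalize real cMat *ᵥ y = z
  ext k
  simp [mulVec, dotProduct, Fintype.sum_prod_type, one_apply, Finset.sum_ite_eq]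

end TetrahedralK3

open TetrahedralK3 Matrix in
/-- There is a group of isometries of the K3 lattice `Λ`, isomorphic to the alternating
group `A₄`, whose fixed lattice `Λ^G` is spanned by four pairwise orthogonal vectors of
self-intersection `−4` (in particular `Λ^G` contains no `(−2)`-vector), and such that the
orthogonal complement `W` of `Λ^G ⊗ ℝ` in `Λ ⊗ ℝ` contains a `G`-invariant positive
definite 3-dimensional subspace `P`, with `W` isomorphic, as a real representation of
`G`, to the direct sum of six copies of `P`. -/
theorem exists_A4_action_on_K3_lattice :
    ∃ ρ : alternatingGroup (Fin 4) →* ((Fin 22 → ℤ) ≃ₗ[ℤ] (Fin 22 → ℤ)),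
      Function.Injective ρ ∧
      (∀ (g : alternatingGroup (Fin 4)) (x y : Fin 22 → ℤ),
        BK3 (ρ g x) (ρ g y) = BK3 x y) ∧
      -- (a) the fixed lattice is spanned by four orthogonal (−4)-vectors
      (∃ v : Fin 4 → (Fin 22 → ℤ),
        (∀ a, BK3 (v a) (v a) = -4) ∧
        (∀ a b, a ≠ b → BK3 (v a) (v b) = 0) ∧
        (∀ x : Fin 22 → ℤ,
          (∀ g, ρ g x = x) ↔ x ∈ Submodule.span ℤ (Set.range v)) ∧
        (∀ x : Fin 22 → ℤ, (∀ g, ρ g x = x) → BK3 x x ≠ -2)) ∧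
      -- (b) the real orthogonal complement W of Λ^G ⊗ ℝ contains an invariant positive
      -- definite 3-plane P and is G-equivariantly isomorphic to P^6
      (∃ P W : Submodule ℝ (Fin 22 → ℝ),
        W = (⨅ x : {x : Fin 22 → ℤ // ∀ g, ρ g x = x},
          LinearMap.ker (BK3R.flip (realify x.1))) ∧
        P ≤ W ∧
        Module.finrank ℝ P = 3 ∧
        (∀ (g : alternatingGroup (Fin 4)), ∀ y ∈ P, extR (ρ g).toLinearMap y ∈ P) ∧
        (∀ y ∈ P, y ≠ 0 → 0 < BK3R y y) ∧
        (∀ (g : alternatingGroup (Fin 4)), ∀ y ∈ W, extR (ρ g).toLinearMap y ∈ W) ∧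
        ∃ e : W ≃ₗ[ℝ] (Fin 6 → P),
          ∀ (g : alternatingGroup (Fin 4)) (y : Fin 22 → ℝ) (hy : y ∈ W)
            (hy' : extR (ρ g).toLinearMap y ∈ W) (m : Fin 6),
            ((e ⟨extR (ρ g).toLinearMap y, hy'⟩ m : Fin 22 → ℝ)) =
              extR (ρ g).toLinearMap ((e ⟨y, hy⟩ m : Fin 22 → ℝ))) := by
  refine ⟨action, action_injective, BK3_action, ⟨vMat.col, ?_, ?_, ?_, ?_⟩, plane, complement,
    complement_eq, plane_le_complement, ?_, ?_, ?_, fun g y hy => extR_action_mem_complement g hy,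
    complementEquivPlane, ?_⟩
  · intro a
    rw [← mulVec_single_one, BK3_mulVec_vMat]
    simp
  · intro a b hab
    rw [← mulVec_single_one, ← mulVec_single_one, BK3_mulVec_vMat]
    simp [hab]
  · intro x
    rw [forall_action_eq_iff, ← range_mulVecLin]
    rfl
  · intro x hx
    obtain ⟨z, rfl⟩ := (forall_action_eq_iff x).1 hx
    rw [BK3_mulVec_vMat]
    omega
  · rw [← planeEquiv.finrank_eq, Module.finrank_fin_fun]
  · rintro g _ ⟨z, rfl⟩
    exact ⟨_, (extR_action_planeMat g z).symm⟩
  · rintro _ ⟨z, rfl⟩ hz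
    rw [toLin'_apply, BK3R_planeMat]
    have hz' : z ≠ 0 := by
      rintro rfl
      exact hz (map_zero _)
    have := dotProduct_self_star_pos_iff.2 hz'
    simp only [star_trivial] at this
    positivity
  · intro g y hy hy' m
    rw [coe_complementEquivPlane, coe_complementEquivPlane, extR_action_planeMat,
      real_cMat_mulVec_extR_action]
end
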